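/- Let n ≥ 1 and let 𝒢_n = {v : Finset (Fin n) → ℝ : v(∅) = 0}. Suppose ψ : 𝒢_n → ℝ^(Fin n) is a linear map satisfying: (symmetry) ψ(σ · v)(i) = ψ(v)(σ⁻¹(i)) for all σ ∈ Equiv.Perm (Fin n), where (σ · v)(S) = v(σ⁻¹(S)); (efficiency) Σ_{i ∈ Fin n} ψ(v)(i) = v(Fin n) for all v; and (null player) whenever a player i satisfies v(S ∪ {i}) = v(S) for every S ⊆ Fin n \ {i}, then ψ(v)(i) = 0. Then ψ is the Shapley value: ψ(v)(i) = Σ_{S ⊆ (Fin n) \ {i}} (|S|! (n − |S| − 1)! / n!) · (v(S ∪ {i}) − v(S)) for every game v and player i. -/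

import Mathlib

/-- The space `𝒢_n` of TU-games on `Fin n`: functions `v : Finset (Fin n) → ℝ` with
`v ∅ = 0`. -/
def gameSpace (n : ℕ) : Submodule ℝ (Finset (Fin n) → ℝ) where
  carrier := {v | v ∅ = 0}
  add_mem' := by
    intro a b ha hb
    simp only [Set.mem_setOf_eq] at *
    simp [ha, hb]
  zero_mem' := by simp
  smul_mem' := by
    intro c v hv
    simp only [Set.mem_setOf_eq] at *
    simp [hv]

/-- The action of `σ ∈ S_n` on games: `(σ • v) S = v (σ⁻¹ S)`. -/
def gamePerm (n : ℕ) (σ : Equiv.Perm (Fin n)) (v : gameSpace n) : gameSpace n :=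
  ⟨fun S => v.1 (S.image ⇑σ⁻¹), by
    show v.1 ((∅ : Finset (Fin n)).image ⇑σ⁻¹) = 0
    rw [Finset.image_empty]
    exact v.2⟩

/-- The Shapley value of player `i` in the TU-game `v` on `Fin n`:
`φ_i(v) = ∑_{S ⊆ N \ {i}} (|S|! (n - |S| - 1)! / n!) (v (S ∪ {i}) - v S)`. -/
noncomputable def shapley (n : ℕ) (v : Finset (Fin n) → ℝ) (i : Fin n) : ℝ :=
  ∑ S ∈ (Finset.univ.erase i).powerset,
    ((S.card.factorial * (n - S.card - 1).factorial : ℕ) : ℝ) / (n.factorial : ℝ) *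
      (v (insert i S) - v S)

/-- The game that is `1` on the coalition `S` and `0` elsewhere (the zero game if `S = ∅`). -/
def diracGame (n : ℕ) (S : Finset (Fin n)) : gameSpace n :=
  ⟨fun T => if T = S ∧ S ≠ ∅ then 1 else 0, if_neg fun h => h.2 h.1.symm⟩

theorem diracGame_apply {n : ℕ} (S T : Finset (Fin n)) :
    (diracGame n S).1 T = if T = S ∧ S ≠ ∅ then 1 else 0 := rfl

theorem diracGame_empty (n : ℕ) : diracGame n ∅ = 0 := by
  ext T
  simp [diracGame_apply]

theorem sum_smul_diracGame {n : ℕ} (v : gameSpace n) :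
    ∑ S, v.1 S • diracGame n S = v := by
  ext T
  have hv : v.1 ∅ = 0 := v.2
  rw [Submodule.coe_sum, Finset.sum_apply, Finset.sum_eq_single T]
  · rcases eq_or_ne T ∅ with rfl | hT
    · simp [hv]
    · simp [diracGame_apply, hT]
  · intro S _ hS
    simp [diracGame_apply, hS.symm]
  · simp

theorem gamePerm_swap_diracGame {n : ℕ} {S : Finset (Fin n)} {i j : Fin n}
    (hi : i ∈ S) (hj : j ∈ S) :
    gamePerm n (Equiv.swap i j) (diracGame n S) = diracGame n S := by
  have hS : S.image (Equiv.swap i j) = S := by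
    refine Finset.eq_of_subset_of_card_le (fun x hx => ?_)
      (Finset.card_image_of_injective _ (Equiv.injective _)).ge
    obtain ⟨y, hy, rfl⟩ := Finset.mem_image.1 hx
    rw [Equiv.swap_apply_def]
    split_ifs <;> assumption
  ext T
  change (diracGame n S).1 (T.image ⇑(Equiv.swap i j)⁻¹) = _
  have hT : T.image (Equiv.swap i j) = S ↔ T = S := by
    conv_lhs => rw [← hS]
    exact (Finset.image_injective (Equiv.injective _)).eq_iff
  simp only [Equiv.swap_inv, diracGame_apply, hT]

section

variable {n : ℕ} {ψ : gameSpace n →ₗ[ℝ] (Fin n → ℝ)}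

theorem value_diracGame_of_notMem
    (hnull : ∀ (v : gameSpace n) (i : Fin n),
      (∀ S : Finset (Fin n), i ∉ S → v.1 (insert i S) = v.1 S) → ψ v i = 0)
    {S : Finset (Fin n)} (hS : S.Nonempty) {i : Fin n} (hi : i ∉ S) :
    ψ (diracGame n S) i = -ψ (diracGame n (insert i S)) i := by
  have h := hnull (diracGame n S + diracGame n (insert i S)) i fun T hT => by
    have h₁ : insert i T ≠ S := fun h => hi (h ▸ Finset.mem_insert_self i T)
    have h₂ : T ≠ insert i S := fun h => hT (h ▸ Finset.mem_insert_self i S)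
    have h₃ : insert i T = insert i S ↔ T = S :=
      ⟨fun h => by rw [← Finset.erase_insert hT, h, Finset.erase_insert hi], fun h => h ▸ rfl⟩
    change (diracGame n S).1 (insert i T) + (diracGame n (insert i S)).1 (insert i T) =
      (diracGame n S).1 T + (diracGame n (insert i S)).1 T
    simp [diracGame_apply, h₁, h₂, h₃, hS.ne_empty]
  rw [map_add, Pi.add_apply] at h
  linarith

theorem value_diracGame_of_mem
    (hsym : ∀ (σ : Equiv.Perm (Fin n)) (v : gameSpace n) (i : Fin n),
      ψ (gamePerm n σ v) i = ψ v (σ⁻¹ i))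
    (heff : ∀ v : gameSpace n, ∑ i, ψ v i = v.1 Finset.univ)
    (hnull : ∀ (v : gameSpace n) (i : Fin n),
      (∀ S : Finset (Fin n), i ∉ S → v.1 (insert i S) = v.1 S) → ψ v i = 0)
    (k : ℕ) {S : Finset (Fin n)} (hk : S.card + k = n) {i : Fin n} (hi : i ∈ S) :
    ψ (diracGame n S) i = ((S.card - 1).factorial * k.factorial : ℕ) / (n.factorial : ℝ) := by
  induction k generalizing S i with
  | zero =>
    obtain rfl : S = Finset.univ := (Finset.card_eq_iff_eq_univ S).1 (by simpa using hk)
    have hconst : ∀ j, ψ (diracGame n Finset.univ) j = ψ (diracGame n Finset.univ) i := fun j => by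
      simpa [gamePerm_swap_diracGame] using
        hsym (Equiv.swap i j) (diracGame n Finset.univ) j
    have h := heff (diracGame n Finset.univ)
    have hne : (Finset.univ : Finset (Fin n)) ≠ ∅ := Finset.ne_empty_of_mem hi
    rw [Finset.sum_congr rfl fun j _ => hconst j, diracGame_apply, if_pos ⟨rfl, hne⟩] at h
    obtain ⟨m, rfl⟩ : ∃ m, n = m + 1 := Nat.exists_eq_succ_of_ne_zero i.pos.ne'
    have hm := Nat.cast_ne_zero (R := ℝ).2 m.factorial_ne_zero
    simp only [Finset.sum_const, Finset.card_univ, Fintype.card_fin, nsmul_eq_mul] at h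
    simp only [Finset.card_univ, Fintype.card_fin, Nat.add_sub_cancel, Nat.factorial_zero,
      mul_one, Nat.factorial_succ]
    push_cast at h ⊢
    field_simp
    linarith
  | succ k ih =>
    have hconst : ∀ j ∈ S, ψ (diracGame n S) j = ψ (diracGame n S) i := fun j hj => by
      simpa [gamePerm_swap_diracGame hi hj] using hsym (Equiv.swap i j) (diracGame n S) j
    have hout : ∀ j ∈ Sᶜ, ψ (diracGame n S) j =
        -((S.card.factorial * k.factorial : ℕ) / (n.factorial : ℝ)) := fun j hj => by
      have hj := Finset.mem_compl.1 hj
      have hcard := Finset.card_insert_of_notMem hj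
      rw [value_diracGame_of_notMem hnull ⟨i, hi⟩ hj,
        ih (by omega) (Finset.mem_insert_self j S), hcard, Nat.add_sub_cancel]
    have hne : Finset.univ ≠ S := fun h => by simp [← h] at hk
    have h := heff (diracGame n S)
    have hc : Sᶜ.card = k + 1 := by rw [Finset.card_compl, Fintype.card_fin]; omega
    rw [diracGame_apply, if_neg (fun h => hne h.1), ← Finset.sum_add_sum_compl S,
      Finset.sum_congr rfl hconst, Finset.sum_congr rfl hout, Finset.sum_const,
      Finset.sum_const, hc, nsmul_eq_mul, nsmul_eq_mul] at h
    obtain ⟨m, hm⟩ : ∃ m, S.card = m + 1 :=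
      Nat.exists_eq_succ_of_ne_zero (Finset.card_ne_zero_of_mem hi)
    have hn := Nat.cast_ne_zero (R := ℝ).2 n.factorial_ne_zero
    have hm₀ : (m : ℝ) + 1 ≠ 0 := by positivity
    rw [hm, Nat.factorial_succ] at h
    rw [hm, Nat.add_sub_cancel, Nat.factorial_succ]
    refine mul_left_cancel₀ hm₀ ?_
    push_cast at h ⊢
    linear_combination h

end

/-- **uniqueness of the Shapley value.** Any linear map `ψ : 𝒢_n → ℝ^(Fin n)`
satisfying symmetry (`ψ(σ • v) i = ψ(v) (σ⁻¹ i)`), efficiency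
(`∑ i, ψ(v) i = v(N)`), and the null player property is the Shapley value. -/
theorem symmetric_efficient_null_value_is_shapley (n : ℕ) (hn : 1 ≤ n)
    (ψ : (gameSpace n) →ₗ[ℝ] (Fin n → ℝ))
    (hsym : ∀ (σ : Equiv.Perm (Fin n)) (v : gameSpace n) (i : Fin n),
      ψ (gamePerm n σ v) i = ψ v (σ⁻¹ i))
    (heff : ∀ v : gameSpace n, ∑ i, ψ v i = v.1 Finset.univ)
    (hnull : ∀ (v : gameSpace n) (i : Fin n),
      (∀ S : Finset (Fin n), i ∉ S → v.1 (insert i S) = v.1 S) → ψ v i = 0) :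
    ∀ (v : gameSpace n) (i : Fin n), ψ v i = shapley n v.1 i := by
  intro v i
  have hexpand : ψ v i = ∑ S, v.1 S * ψ (diracGame n S) i := by
    conv_lhs => rw [← sum_smul_diracGame v]
    simp [map_sum, Finset.sum_apply]
  have hv : v.1 ∅ = 0 := v.2
  rw [hexpand, shapley, ← Finset.powerset_univ,
    ← Finset.insert_erase (Finset.mem_univ i),
    Finset.sum_powerset_insert (Finset.notMem_erase i _), ← Finset.sum_add_distrib,
    Finset.insert_erase (Finset.mem_univ i)]
  refine Finset.sum_congr rfl fun S hS => ?_
  have hi : i ∉ S := fun h => Finset.notMem_erase i _ (Finset.mem_powerset.1 hS h)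
  have hcard := Finset.card_insert_of_notMem hi
  have hle : (insert i S).card ≤ n := by simpa using Finset.card_le_univ (insert i S)
  have hval := value_diracGame_of_mem hsym heff hnull (n - S.card - 1) (by omega)
    (Finset.mem_insert_self i S)
  rw [hcard, Nat.add_sub_cancel] at hval
  rw [hval]
  rcases S.eq_empty_or_nonempty with rfl | hne
  · rw [hv]
    ring
  · rw [value_diracGame_of_notMem hnull hne hi, hval]
    ring
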